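/- (Corollary 3.6) For every s ≥ 0 there exists a constant C(s,q) < ∞ such that |𝔐|²_{s;M} := Σ_{h∈ℕ₀} ⟨h⟩^{2s} · sup{ ‖𝔐_{[n]}^{[m]}‖²_HS : n,m ∈ ℕ₀, |n−m| = h } ≤ C(s,q). -/

import Mathlib

/-
Corollary 3.6: s-decay of the basis-change matrix 𝔐 between the eigenfunction basis
(ψ_j) of the Schrödinger operator L_q = −∂_xx + q(x) and the exponential basis (e_m)
on the torus 𝕋 = ℝ/(2πℤ). Functions on 𝕋 are represented as 2π-periodic functions ℝ → ℂ.
-/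

noncomputable section

open scoped Real

/-- Japanese bracket `⟨m⟩ = max {1, |m|}`. -/
def jap (m : ℤ) : ℝ := max 1 |(m : ℝ)|

/-- Normalized `L²(𝕋)` inner product `(f,g) = (2π)⁻¹ ∫_0^{2π} f(x) conj(g(x)) dx`. -/
def tInner (f g : ℝ → ℂ) : ℂ :=
  ((2 * π)⁻¹ : ℝ) • ∫ x in (0 : ℝ)..(2 * π), f x * (starRingEnd ℂ) (g x)

/-- The exponential `e_m(x) = e^{imx}`. -/
def eFun (m : ℤ) : ℝ → ℂ := fun x => Complex.exp (Complex.I * (m : ℂ) * (x : ℂ))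

/-- The block index set `[n]`: `[0] = {0}`, `[n] = {−n, n}` for `n ≥ 1`. -/
def blockSet (n : ℕ) : Finset ℤ := {(n : ℤ), -(n : ℤ)}

/-- Squared Hilbert–Schmidt norm `‖𝔐_{[n]}^{[m]}‖²_HS` of the block of the basis-change
matrix, whose entries are `(ψ_j, e_{j'})_{L²}`, `j ∈ [n]`, `j' ∈ [m]`. -/
def blockHSsq (ψ : ℤ → ℝ → ℂ) (n m : ℕ) : ℝ :=
  ∑ j ∈ blockSet n, ∑ j' ∈ blockSet m, ‖tInner (ψ j) (eFun j')‖ ^ 2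

/-- smooth 2π-periodic functions -/
def SmPer (p : ℝ → ℂ) : Prop := ContDiff ℝ (⊤ : ℕ∞) p ∧ Function.Periodic p (2 * π)

lemma SmPer.deriv {p : ℝ → ℂ} (hp : SmPer p) : SmPer (deriv p) := by
  refine ⟨(contDiff_infty_iff_deriv.1 hp.1).2, fun x => ?_⟩
  rw [← deriv_comp_add_const]
  congr 1
  funext y
  exact hp.2 y

lemma SmPer.hasDeriv {p : ℝ → ℂ} (hp : SmPer p) (x : ℝ) : HasDerivAt p (_root_.deriv p x) x :=
  ((contDiff_infty_iff_deriv.1 hp.1).1 x).hasDerivAt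

lemma SmPer.cont {p : ℝ → ℂ} (hp : SmPer p) : Continuous p := hp.1.continuous

lemma SmPer.mul {p r : ℝ → ℂ} (hp : SmPer p) (hr : SmPer r) : SmPer (fun x => p x * r x) :=
  ⟨hp.1.mul hr.1, fun x => by simp only [hp.2 x, hr.2 x]⟩

lemma SmPer.sub {p r : ℝ → ℂ} (hp : SmPer p) (hr : SmPer r) : SmPer (fun x => p x - r x) :=
  ⟨hp.1.sub hr.1, fun x => by simp only [hp.2 x, hr.2 x]⟩

lemma SmPer.bdd {p : ℝ → ℂ} (hp : SmPer p) : ∃ C, 0 ≤ C ∧ ∀ x ∈ Set.Icc 0 (2 * π), ‖p x‖ ≤ C := by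
  obtain ⟨C, hC⟩ := (isCompact_Icc (a := (0:ℝ)) (b := 2 * π)).exists_bound_of_continuousOn
    hp.cont.continuousOn
  exact ⟨C, (norm_nonneg _).trans (hC 0 ⟨le_rfl, by positivity⟩), hC⟩

lemma hasDeriv_eFun (m : ℤ) (x : ℝ) :
    HasDerivAt (eFun m) (Complex.I * m * eFun m x) x := by
  have h1 : HasDerivAt (fun y : ℝ => Complex.I * (m : ℂ) * (y : ℂ)) (Complex.I * m * 1) x :=
    (Complex.ofRealCLM.hasDerivAt (x := x)).const_mul _
  refine HasDerivAt.congr_deriv (f := eFun m) h1.cexp ?_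
  change eFun m x * _ = _
  ring

lemma smPer_eFun (m : ℤ) : SmPer (eFun m) := by
  constructor
  · unfold eFun
    exact (contDiff_const.mul Complex.ofRealCLM.contDiff).cexp
  · intro x
    unfold eFun
    rw [Complex.exp_eq_exp_iff_exists_int]
    refine ⟨m, ?_⟩
    push_cast; ring

lemma norm_eFun (m : ℤ) (x : ℝ) : ‖eFun m x‖ = 1 := by
  unfold eFun
  rw [show Complex.I * (m : ℂ) * (x : ℂ) = ((m * x : ℝ) : ℂ) * Complex.I by push_cast; ring]
  exact Complex.norm_exp_ofReal_mul_I _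

lemma conj_eFun (m : ℤ) (x : ℝ) : (starRingEnd ℂ) (eFun m x) = eFun (-m) x := by
  unfold eFun
  rw [← Complex.exp_conj]
  simp

lemma ibp1 {u v : ℝ → ℂ} (hu : SmPer u) (hv : SmPer v) :
    ∫ x in (0:ℝ)..(2 * π), u x * deriv v x = - ∫ x in (0:ℝ)..(2 * π), deriv u x * v x := by
  rw [intervalIntegral.integral_mul_deriv_eq_deriv_mul (fun x _ => hu.hasDeriv x)
    (fun x _ => hv.hasDeriv x) (hu.deriv.cont.intervalIntegrable _ _)
    (hv.deriv.cont.intervalIntegrable _ _)]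
  have h1 := hu.2 0
  have h2 := hv.2 0
  rw [zero_add] at h1 h2
  rw [h1, h2]; ring

lemma ibp2 {u v : ℝ → ℂ} (hu : SmPer u) (hv : SmPer v) :
    ∫ x in (0:ℝ)..(2 * π), deriv (deriv u) x * v x
      = ∫ x in (0:ℝ)..(2 * π), u x * deriv (deriv v) x := by
  rw [ibp1 hu hv.deriv, ibp1 hu.deriv hv, neg_neg]

lemma deriv2_mul_eFun {p : ℝ → ℂ} (hp : SmPer p) (m : ℤ) (x : ℝ) :
    deriv (deriv (fun x => p x * eFun m x)) x
      = deriv (deriv p) x * eFun m x + 2 * Complex.I * m * (deriv p x * eFun m x)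
        - (m : ℂ) ^ 2 * (p x * eFun m x) := by
  have h1 : deriv (fun x => p x * eFun m x)
      = fun x => deriv p x * eFun m x + p x * (Complex.I * m * eFun m x) := by
    funext y
    exact ((hp.hasDeriv y).mul (hasDeriv_eFun m y)).deriv
  rw [h1]
  have := (((hp.deriv.hasDeriv x).mul (hasDeriv_eFun m x)).add
    ((hp.hasDeriv x).mul ((hasDeriv_eFun m x).const_mul (Complex.I * m)))).deriv
  refine Eq.trans this ?_
  linear_combination (m : ℂ) ^ 2 * p x * eFun m x * Complex.I_sq

lemma step {q : ℝ → ℂ} (hq : SmPer q) {ψ : ℝ → ℂ} (hψ : SmPer ψ) {μ : ℂ}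
    (he : ∀ x, -(deriv (deriv ψ) x) + q x * ψ x = μ * ψ x) {p : ℝ → ℂ} (hp : SmPer p) (m : ℤ) :
    (μ - (m : ℂ) ^ 2) * ∫ x in (0:ℝ)..(2 * π), ψ x * (p x * eFun m x)
      = (∫ x in (0:ℝ)..(2 * π), ψ x * ((q x * p x - deriv (deriv p) x) * eFun m x))
        - 2 * Complex.I * m * ∫ x in (0:ℝ)..(2 * π), ψ x * (deriv p x * eFun m x) := by
  have hpe := hp.mul (smPer_eFun m)
  have key := ibp2 hψ hpe
  have i1 : ∀ {f : ℝ → ℂ}, SmPer f →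
      IntervalIntegrable f MeasureTheory.volume 0 (2 * π) :=
    fun hf => hf.cont.intervalIntegrable _ _
  have hA := hψ.mul hpe
  have hB := hψ.mul (((hq.mul hp).sub hp.deriv.deriv).mul (smPer_eFun m))
  have hC := hψ.mul (hp.deriv.mul (smPer_eFun m))
  have e1 : ∫ x in (0:ℝ)..(2 * π), deriv (deriv ψ) x * (p x * eFun m x)
      = ∫ x in (0:ℝ)..(2 * π), (q x * (ψ x * (p x * eFun m x)) - μ * (ψ x * (p x * eFun m x))) := by
    congr 1; funext x; linear_combination (-(p x * eFun m x)) * he x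
  have e2 : ∫ x in (0:ℝ)..(2 * π), ψ x * deriv (deriv (fun x => p x * eFun m x)) x
      = ∫ x in (0:ℝ)..(2 * π), (q x * (ψ x * (p x * eFun m x))
        - (ψ x * ((q x * p x - deriv (deriv p) x) * eFun m x))
        + 2 * Complex.I * m * (ψ x * (deriv p x * eFun m x))
        - (m : ℂ) ^ 2 * (ψ x * (p x * eFun m x))) := by
    congr 1; funext x; rw [deriv2_mul_eFun hp]; ring
  rw [e1, e2, intervalIntegral.integral_sub (i1 (hq.mul hA)) ((i1 hA).const_mul _),
    intervalIntegral.integral_sub (((i1 (hq.mul hA)).sub (i1 hB)).add ((i1 hC).const_mul _))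
      ((i1 hA).const_mul _),
    intervalIntegral.integral_add ((i1 (hq.mul hA)).sub (i1 hB)) ((i1 hC).const_mul _),
    intervalIntegral.integral_sub (i1 (hq.mul hA)) (i1 hB),
    intervalIntegral.integral_const_mul, intervalIntegral.integral_const_mul,
    intervalIntegral.integral_const_mul] at key
  linear_combination -key

lemma base {p : ℝ → ℂ} (hp : SmPer p) : ∃ C : ℝ, 0 ≤ C ∧ ∀ (ψ : ℝ → ℂ) (m : ℤ), SmPer ψ →
    tInner ψ ψ = 1 → ‖∫ x in (0:ℝ)..(2 * π), ψ x * (p x * eFun m x)‖ ≤ C := by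
  obtain ⟨B, hB0, hB⟩ := hp.bdd
  refine ⟨B * (2 * π), by positivity, fun ψ m hψ h1 => ?_⟩
  have hπ : (0:ℝ) ≤ 2 * π := by positivity
  have hn : ∫ x in (0:ℝ)..(2 * π), ‖ψ x‖ ^ 2 = 2 * π := by
    unfold tInner at h1
    have : ∀ x, ψ x * (starRingEnd ℂ) (ψ x) = ((‖ψ x‖ ^ 2 : ℝ) : ℂ) := fun x => by
      rw [Complex.mul_conj, Complex.normSq_eq_norm_sq]
    simp_rw [this] at h1
    rw [intervalIntegral.integral_ofReal, Complex.real_smul, ← Complex.ofReal_mul] at h1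
    have h2 : (2 * π)⁻¹ * ∫ x in (0:ℝ)..(2 * π), ‖ψ x‖ ^ 2 = 1 := by exact_mod_cast h1
    field_simp at h2
    linarith
  have c2 : Continuous fun x => ‖ψ x‖ ^ 2 := hψ.cont.norm.pow 2
  calc ‖∫ x in (0:ℝ)..(2 * π), ψ x * (p x * eFun m x)‖
      ≤ ∫ x in (0:ℝ)..(2 * π), ‖ψ x * (p x * eFun m x)‖ :=
        intervalIntegral.norm_integral_le_integral_norm hπ
    _ ≤ ∫ x in (0:ℝ)..(2 * π), (B / 2 + B / 2 * ‖ψ x‖ ^ 2) := by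
        apply intervalIntegral.integral_mono_on hπ
        · exact ((hψ.mul (hp.mul (smPer_eFun m))).cont.norm).intervalIntegrable _ _
        · exact (continuous_const.add (continuous_const.mul c2)).intervalIntegrable _ _
        · intro x hx
          rw [norm_mul, norm_mul, norm_eFun, mul_one]
          have := mul_le_mul_of_nonneg_left (hB x hx) (norm_nonneg (ψ x))
          nlinarith [mul_nonneg hB0 (sq_nonneg (‖ψ x‖ - 1))]
    _ = B * (2 * π) := by
        rw [intervalIntegral.integral_add (continuous_const.intervalIntegrable _ _)
          ((c2.intervalIntegrable _ _).const_mul _),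
          intervalIntegral.integral_const_mul, hn]
        simp; ring

lemma jap_one_le (m : ℤ) : 1 ≤ jap m := le_max_left _ _
lemma jap_abs_le (m : ℤ) : |(m : ℝ)| ≤ jap m := le_max_right _ _

lemma decay {q : ℝ → ℂ} (hq : SmPer q) (ψ : ℤ → ℝ → ℂ) (hψ : ∀ j, SmPer (ψ j)) (μ : ℤ → ℝ)
    (he : ∀ j x, -(deriv (deriv (ψ j)) x) + q x * ψ j x = (μ j : ℂ) * ψ j x)
    (hn : ∀ j, tInner (ψ j) (ψ j) = 1) (k : ℕ) :
    ∀ p : ℝ → ℂ, SmPer p → ∃ C : ℝ, 0 ≤ C ∧ ∀ j m : ℤ,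
      |μ j - (m : ℝ) ^ 2| ^ k * ‖∫ x in (0:ℝ)..(2 * π), ψ j x * (p x * eFun m x)‖
        ≤ C * jap m ^ k := by
  induction k with
  | zero =>
    intro p hp
    obtain ⟨C, h0, hC⟩ := base hp
    exact ⟨C, h0, fun j m => by simpa using hC (ψ j) m (hψ j) (hn j)⟩
  | succ k ih =>
    intro p hp
    obtain ⟨C1, h1, hC1⟩ := ih _ ((hq.mul hp).sub hp.deriv.deriv)
    obtain ⟨C2, h2, hC2⟩ := ih _ hp.deriv
    refine ⟨C1 + 2 * C2, by positivity, fun j m => ?_⟩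
    have hs := step hq (hψ j) (he j) hp m
    have e : ‖((μ j : ℂ) - (m : ℂ) ^ 2)‖ = |μ j - (m : ℝ) ^ 2| := by
      rw [← Real.norm_eq_abs, ← Complex.norm_real]; push_cast; rfl
    have hs' := congrArg norm hs
    rw [norm_mul, e] at hs'
    have J1 := jap_one_le m
    have Jm := jap_abs_le m
    have e2 : ‖(2 * Complex.I * (m : ℂ))‖ = 2 * |(m : ℝ)| := by
      simp
    rw [pow_succ, mul_assoc, hs']
    calc _ ≤ |μ j - (m : ℝ) ^ 2| ^ k * (_ + _) :=
          mul_le_mul_of_nonneg_left (norm_sub_le _ _) (by positivity)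
      _ ≤ C1 * jap m ^ k + 2 * jap m * (C2 * jap m ^ k) := by
          rw [norm_mul, e2, mul_add]
          refine add_le_add (hC1 j m) ?_
          rw [mul_left_comm]
          exact mul_le_mul (by linarith) (hC2 j m) (by positivity) (by positivity)
      _ ≤ _ := by
          rw [pow_succ]
          have : 0 ≤ jap m ^ k := by positivity
          nlinarith [mul_nonneg (mul_nonneg h1 this) (sub_nonneg.2 J1)]

lemma coef_decay {q : ℝ → ℂ} (hq : SmPer q) (ψ : ℤ → ℝ → ℂ) (hψ : ∀ j, SmPer (ψ j)) (μ : ℤ → ℝ)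
    (he : ∀ j x, -(deriv (deriv (ψ j)) x) + q x * ψ j x = (μ j : ℂ) * ψ j x)
    (hn : ∀ j, tInner (ψ j) (ψ j) = 1) (D : ℝ) (hD : ∀ j : ℤ, |μ j - (j : ℝ) ^ 2| ≤ D) (k : ℕ) :
    ∃ C : ℝ, 0 ≤ C ∧ ∀ j m : ℤ,
      jap (|j| - |m|) ^ k * ‖tInner (ψ j) (eFun m)‖ ≤ C := by
  have hone : SmPer (fun _ => (1:ℂ)) := ⟨contDiff_const, fun _ => rfl⟩
  obtain ⟨C, hC0, hC⟩ := decay hq ψ hψ μ he hn k _ hone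
  obtain ⟨C', hC0', hC'⟩ := decay hq ψ hψ μ he hn 0 _ hone
  have hD0 : 0 ≤ D := (abs_nonneg _).trans (hD 0)
  set a : ℝ := (2 * π)⁻¹ with ha
  have ha0 : 0 < a := by positivity
  refine ⟨a * (2 ^ k * (C + D ^ k * C') + C'), by positivity, fun j m => ?_⟩
  have ec : ‖tInner (ψ j) (eFun m)‖
      = a * ‖∫ x in (0:ℝ)..(2 * π), ψ j x * ((1:ℂ) * eFun (-m) x)‖ := by
    unfold tInner
    rw [norm_smul, Real.norm_of_nonneg (by positivity)]
    simp only [conj_eFun, one_mul, ha]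
  rw [ec]
  have h1 := hC j (-m)
  have h2 := hC' j (-m)
  set c := ‖∫ x in (0:ℝ)..(2 * π), ψ j x * ((1:ℂ) * eFun (-m) x)‖ with hc
  have hc0 : 0 ≤ c := norm_nonneg _
  have J1 := jap_one_le (-m)
  set J := jap (-m) with hJ
  simp only [pow_zero, one_mul, mul_one] at h2
  set h : ℝ := |(|(j:ℝ)| - |(m:ℝ)|)| with hh
  have hh0 : 0 ≤ h := abs_nonneg _
  have hJh : h * J ≤ |μ j - ((-m : ℤ) : ℝ) ^ 2| + D := by
    have l1 : h * J ≤ |(j:ℝ) ^ 2 - (m:ℝ) ^ 2| := by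
      rw [← sq_abs (j:ℝ), ← sq_abs (m:ℝ), sq_sub_sq, abs_mul, mul_comm h,
        abs_of_nonneg (by positivity : 0 ≤ |(j:ℝ)| + |(m:ℝ)|)]
      by_cases hz : h = 0
      · rw [← hh, hz]; simp
      refine mul_le_mul_of_nonneg_right ?_ hh0
      rw [hJ]; unfold jap
      apply max_le
      · by_contra hlt
        push Not at hlt
        apply hz
        have : |j| + |m| < 1 := by exact_mod_cast hlt
        have hj : j = 0 := by
          have := abs_nonneg m; have := abs_nonneg j
          exact abs_eq_zero.1 (by omega)
        have hm : m = 0 := by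
          have := abs_nonneg m; have := abs_nonneg j
          exact abs_eq_zero.1 (by omega)
        rw [hh, hj, hm]; simp
      · push_cast; rw [abs_neg]; linarith [abs_nonneg (j:ℝ)]
    have l2 : (j:ℝ) ^ 2 - (m:ℝ) ^ 2 = (μ j - ((-m : ℤ) : ℝ) ^ 2) - (μ j - (j:ℝ) ^ 2) := by
      push_cast; ring
    rw [l2] at l1
    exact l1.trans ((abs_sub _ _).trans (by linarith [hD j]))
  set L := |μ j - ((-m : ℤ) : ℝ) ^ 2| with hL
  have hL0 : 0 ≤ L := abs_nonneg _
  have hk : h ^ k * c ≤ 2 ^ k * (C + D ^ k * C') := by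
    have hJk : 1 ≤ J ^ k := one_le_pow₀ J1
    have s1 : (h * J) ^ k ≤ 2 ^ k * (L ^ k + D ^ k) := by
      have : h * J ≤ 2 * max L D := by linarith [le_max_left L D, le_max_right L D]
      refine (pow_le_pow_left₀ (by positivity) this k).trans ?_
      rw [mul_pow]
      refine mul_le_mul_of_nonneg_left ?_ (by positivity)
      rcases max_cases L D with ⟨e, _⟩ | ⟨e, _⟩ <;> rw [e]
      · linarith [pow_nonneg hD0 k]
      · linarith [pow_nonneg hL0 k]
    have s2 : (h ^ k * c) * J ^ k ≤ (2 ^ k * (C + D ^ k * C')) * J ^ k := by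
      calc (h ^ k * c) * J ^ k = (h * J) ^ k * c := by rw [mul_pow]; ring
        _ ≤ 2 ^ k * (L ^ k + D ^ k) * c := mul_le_mul_of_nonneg_right s1 hc0
        _ = 2 ^ k * (L ^ k * c + D ^ k * c) := by ring
        _ ≤ 2 ^ k * (C * J ^ k + D ^ k * C' * J ^ k) := by
          refine mul_le_mul_of_nonneg_left (add_le_add h1 ?_) (by positivity)
          calc D ^ k * c ≤ D ^ k * C' := mul_le_mul_of_nonneg_left h2 (by positivity)
            _ ≤ _ := le_mul_of_one_le_right (by positivity) hJk
        _ = _ := by ring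
    exact le_of_mul_le_mul_right s2 (by positivity)
  have ej : jap (|j| - |m|) = max 1 h := by
    unfold jap; rw [hh]; push_cast; rfl
  rw [ej, mul_left_comm]
  refine mul_le_mul_of_nonneg_left ?_ ha0.le
  rcases max_cases 1 h with ⟨e, _⟩ | ⟨e, _⟩ <;> rw [e]
  · rw [one_pow, one_mul]
    have : 0 ≤ 2 ^ k * (C + D ^ k * C') := by positivity
    linarith
  · linarith

lemma blockSet_abs {n : ℕ} {j : ℤ} (hj : j ∈ blockSet n) : |j| = n := by
  unfold blockSet at hj
  simp only [Finset.mem_insert, Finset.mem_singleton] at hj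
  rcases hj with rfl | rfl <;> simp

lemma blockSet_card (n : ℕ) : (blockSet n).card ≤ 2 := Finset.card_le_two

/-- **Corollary 3.6.** For every `s ≥ 0` there is a constant `C = C(s,q) < ∞` bounding
`|𝔐|²_{s;M} = Σ_h ⟨h⟩^{2s} sup_{|n−m|=h} ‖𝔐_{[n]}^{[m]}‖²_HS`; equivalently, every finite
sum along every selection of blocks with `|n−m| = h` is bounded by `C`. -/
theorem corollary_3_6
    (q : ℝ → ℝ) (hq : ContDiff ℝ (⊤ : ℕ∞) q) (hqper : Function.Periodic q (2 * π))
    (ψ : ℤ → ℝ → ℂ) (hψ : ∀ j, ContDiff ℝ (⊤ : ℕ∞) (ψ j))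
    (hψper : ∀ j, Function.Periodic (ψ j) (2 * π))
    (μsq : ℤ → ℝ)
    (heig : ∀ (j : ℤ) (x : ℝ),
      -(deriv (deriv (ψ j)) x) + (q x : ℂ) * ψ j x = (μsq j : ℂ) * ψ j x)
    (qbar : ℝ) (hqbar : qbar = (2 * π)⁻¹ * ∫ x in (0 : ℝ)..(2 * π), q x)
    (d : ℤ → ℝ) (hd : ∀ j : ℤ, μsq j = (j : ℝ) ^ 2 + qbar + d j)
    (hdsum : Summable fun j : ℤ => (d j) ^ 2)
    (hortho : ∀ j k : ℤ, tInner (ψ j) (ψ k) = if j = k then 1 else 0)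
    (hcomplete : ∀ f : ℝ → ℂ, Continuous f → Function.Periodic f (2 * π) →
      (∀ j : ℤ, tInner f (ψ j) = 0) → f = 0)
    (s : ℝ) (hs : 0 ≤ s) :
    ∃ C : ℝ, ∀ (N : ℕ) (nn mm : ℕ → ℕ),
      (∀ h : ℕ, ((nn h : ℤ) - (mm h : ℤ)).natAbs = h) →
      ∑ h ∈ Finset.range N, jap (h : ℤ) ^ (2 * s) * blockHSsq ψ (nn h) (mm h) ≤ C := by
  have hqs : SmPer (fun x => (q x : ℂ)) :=
    ⟨Complex.ofRealCLM.contDiff.comp hq, fun x => by simp only [hqper x]⟩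
  have hψs : ∀ j, SmPer (ψ j) := fun j => ⟨hψ j, hψper j⟩
  have hn : ∀ j, tInner (ψ j) (ψ j) = 1 := fun j => by rw [hortho, if_pos rfl]
  have hD : ∀ j : ℤ, |μsq j - (j : ℝ) ^ 2| ≤ |qbar| + (1 + ∑' j : ℤ, d j ^ 2) := by
    intro j
    have h1 : d j ^ 2 ≤ ∑' j : ℤ, d j ^ 2 :=
      hdsum.le_tsum j (fun i _ => sq_nonneg _)
    have h2 : |d j| ≤ 1 + d j ^ 2 := by
      rw [← sq_abs]; nlinarith [sq_nonneg (|d j| - 1), abs_nonneg (d j)]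
    have h3 : μsq j - (j : ℝ) ^ 2 = qbar + d j := by rw [hd j]; ring
    rw [h3]
    linarith [abs_add_le qbar (d j)]
  obtain ⟨k, hk⟩ := exists_nat_ge (s + 1)
  obtain ⟨C, hC0, hC⟩ := coef_decay hqs ψ hψs μsq heig hn _ hD k
  have hsum : Summable fun h : ℕ => 16 * C ^ 2 * (1 / ((h : ℝ) + 1) ^ 2) := by
    have := (summable_nat_add_iff 1).2 (Real.summable_one_div_nat_pow.2 (by norm_num : 1 < 2))
    exact (by simpa using this : Summable fun h : ℕ => 1 / ((h : ℝ) + 1) ^ 2).mul_left _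
  refine ⟨∑' h : ℕ, 16 * C ^ 2 * (1 / ((h : ℝ) + 1) ^ 2), fun N nn mm hnm => ?_⟩
  refine le_trans (Finset.sum_le_sum fun h _ => ?_)
    (hsum.sum_le_tsum (Finset.range N) (fun i _ => by positivity))
  set J := jap (h : ℤ) with hJ
  have J1 : 1 ≤ J := jap_one_le _
  have J0 : 0 < J := by linarith
  have hent : ∀ j ∈ blockSet (nn h), ∀ j' ∈ blockSet (mm h),
      ‖tInner (ψ j) (eFun j')‖ ^ 2 ≤ C ^ 2 / J ^ (2 * k) := by
    intro j hj j' hj'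
    have h1 := hC j j'
    rw [blockSet_abs hj, blockSet_abs hj'] at h1
    have e : jap ((nn h : ℤ) - (mm h : ℤ)) = J := by
      rw [hJ]; unfold jap
      have := hnm h
      have h3 : |((nn h : ℤ) - (mm h : ℤ))| = |(h : ℤ)| := by
        rw [Int.abs_eq_natAbs, this]; simp
      have h4 : |(((nn h : ℤ) - (mm h : ℤ) : ℤ) : ℝ)| = |((h : ℤ) : ℝ)| := by
        exact_mod_cast h3
      rw [h4]
    rw [e] at h1
    rw [le_div_iff₀ (by positivity)]
    calc _ = (J ^ k * ‖tInner (ψ j) (eFun j')‖) ^ 2 := by rw [mul_pow]; ring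
      _ ≤ _ := pow_le_pow_left₀ (by positivity) h1 2
  have hE0 : 0 ≤ C ^ 2 / J ^ (2 * k) := by positivity
  have hblock : blockHSsq ψ (nn h) (mm h) ≤ 4 * (C ^ 2 / J ^ (2 * k)) := by
    unfold blockHSsq
    have c1 : ((blockSet (nn h)).card : ℝ) ≤ 2 := by exact_mod_cast blockSet_card _
    have c2 : ((blockSet (mm h)).card : ℝ) ≤ 2 := by exact_mod_cast blockSet_card _
    have inner : ∀ j ∈ blockSet (nn h),
        ∑ j' ∈ blockSet (mm h), ‖tInner (ψ j) (eFun j')‖ ^ 2 ≤ 2 * (C ^ 2 / J ^ (2 * k)) := by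
      intro j hj
      refine (Finset.sum_le_card_nsmul _ _ _ (hent j hj)).trans ?_
      rw [nsmul_eq_mul]
      exact mul_le_mul_of_nonneg_right c2 hE0
    refine (Finset.sum_le_card_nsmul _ _ _ inner).trans ?_
    rw [nsmul_eq_mul]
    nlinarith
  have hpow : J ^ (2 * s) * J ^ 2 ≤ J ^ (2 * k) := by
    rw [← Real.rpow_natCast J 2, ← Real.rpow_natCast J (2 * k), ← Real.rpow_add J0]
    apply Real.rpow_le_rpow_of_exponent_le J1
    push_cast; linarith
  have hh : (h : ℝ) + 1 ≤ 2 * J := by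
    have : |((h : ℤ) : ℝ)| ≤ J := jap_abs_le _
    have h2 : |((h : ℤ) : ℝ)| = h := by simp
    linarith
  have hh2 : ((h : ℝ) + 1) ^ 2 ≤ 4 * J ^ 2 := by
    have := pow_le_pow_left₀ (by positivity) hh 2
    linarith [mul_pow 2 J 2]
  have hr0 : 0 ≤ J ^ (2 * s) := Real.rpow_nonneg J0.le _
  calc J ^ (2 * s) * blockHSsq ψ (nn h) (mm h)
      ≤ J ^ (2 * s) * (4 * (C ^ 2 / J ^ (2 * k))) := mul_le_mul_of_nonneg_left hblock hr0
    _ ≤ 4 * C ^ 2 / J ^ 2 := by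
        rw [le_div_iff₀ (by positivity)]
        rw [show J ^ (2 * s) * (4 * (C ^ 2 / J ^ (2 * k))) * J ^ 2
          = 4 * C ^ 2 * (J ^ (2 * s) * J ^ 2) / J ^ (2 * k) by ring]
        rw [div_le_iff₀ (by positivity)]
        exact mul_le_mul_of_nonneg_left hpow (by positivity)
    _ ≤ 16 * C ^ 2 * (1 / ((h : ℝ) + 1) ^ 2) := by
        rw [mul_one_div, div_le_div_iff₀ (by positivity) (by positivity)]
        nlinarith [mul_le_mul_of_nonneg_left hh2 (sq_nonneg C)]
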